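/- Let S be a numerical semigroup with multiplicity e and blowup B with generating set D. Let f ∈ Ap(B; e) and s′ = f + ord(f; D)·e, where ord(f;D) is the maximal length of a D-factorization of f. Then for all k ≥ 0, the maximal denumerant d_max(s′ + ke; S) equals the denumerant d(f; D), the total number of D-factorizations of f. -/

import Mathlib

open Finset

/-- The set of factorizations of `n` over the generating tuple `g`. -/
def Fac {t : ℕ} (g : Fin (t + 1) → ℕ) (n : ℕ) : Set (Fin (t + 1) → ℕ) :=
  {c | ∑ i, c i * g i = n}

/-- The numerical semigroup generated by the tuple `g`. -/
def Sg {t : ℕ} (g : Fin (t + 1) → ℕ) : Set ℕ :=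
  {n | ∃ c : Fin (t + 1) → ℕ, ∑ i, c i * g i = n}

/-- The order of `n`: the maximal length of a factorization of `n` over `g`. -/
noncomputable def ordOf {t : ℕ} (g : Fin (t + 1) → ℕ) (n : ℕ) : ℕ :=
  sSup {r | ∃ c ∈ Fac g n, ∑ i, c i = r}

/-- The minimal length of a factorization of `n` over `g`. -/
noncomputable def minordOf {t : ℕ} (g : Fin (t + 1) → ℕ) (n : ℕ) : ℕ :=
  sInf {r | ∃ c ∈ Fac g n, ∑ i, c i = r}

/-- The denumerant of `n` with respect to `g`. -/
noncomputable def denum {t : ℕ} (g : Fin (t + 1) → ℕ) (n : ℕ) : ℕ :=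
  (Fac g n).ncard

/-- The maximal denumerant of an element: the number of maximal-length factorizations. -/
noncomputable def dmaxEl {t : ℕ} (g : Fin (t + 1) → ℕ) (n : ℕ) : ℕ :=
  {c ∈ Fac g n | ∑ i, c i = ordOf g n}.ncard

/-- The maximal denumerant of the semigroup generated by `g`. -/
noncomputable def dmax {t : ℕ} (g : Fin (t + 1) → ℕ) : ℕ :=
  sSup {m | ∃ n ∈ Sg g, dmaxEl g n = m}

/-- The generating tuple `D` of the blowup: `{e, a₁ - e, …, a_t - e}`. -/
def blowD {t : ℕ} (g : Fin (t + 1) → ℕ) : Fin (t + 1) → ℕ :=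
  fun i => if i = 0 then g 0 else g i - g 0

/-- The adjustment of `n`:  `n - ord(n) * e`. -/
noncomputable def adj {t : ℕ} (g : Fin (t + 1) → ℕ) (n : ℕ) : ℕ :=
  n - ordOf g n * g 0

/-- The Apery set with respect to `u` of the semigroup generated by `g`. -/
def Ap {t : ℕ} (g : Fin (t + 1) → ℕ) (u : ℕ) : Set ℕ :=
  {w ∈ Sg g | ¬ ∃ b ∈ Sg g, w = b + u}

/-- `g` is the (strictly increasing) minimal generating tuple of a numerical semigroup
with multiplicity `g 0`. -/
structure IsNumSgp {t : ℕ} (g : Fin (t + 1) → ℕ) : Prop where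
  mono : StrictMono g
  pos : 0 < g 0
  gcd_eq_one : Finset.gcd Finset.univ g = 1
  minimal : ∀ i, ∀ c : Fin (t + 1) → ℕ, ∑ j, c j * g j = g i → c = Pi.single i 1

/-- `S` is additive: `ord(u + e) = ord(u) + 1` for all `u ∈ S`. -/
def IsAdditive {t : ℕ} (g : Fin (t + 1) → ℕ) : Prop :=
  ∀ u ∈ Sg g, ordOf g (u + g 0) = ordOf g u + 1

/-- Membership of an integer in a set of naturals. -/
def ZMem (T : Set ℕ) (z : ℤ) : Prop := 0 ≤ z ∧ z.toNat ∈ T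

/-- The Frobenius number: the largest integer not in `T`. -/
noncomputable def Frob (T : Set ℕ) : ℤ := sSup {z : ℤ | ¬ ZMem T z}

/-- `T` is symmetric: whenever `x + y = F(T)`, exactly one of `x`, `y` lies in `T`. -/
def Symm (T : Set ℕ) : Prop := ∀ x y : ℤ, x + y = Frob T → (ZMem T x ↔ ¬ ZMem T y)

/-- An abstract numerical semigroup. -/
structure IsNumSemigroup (T : Set ℕ) : Prop where
  zero_mem : 0 ∈ T
  add_mem : ∀ a ∈ T, ∀ b ∈ T, a + b ∈ T
  cofinite : Tᶜ.Finite

/-- The Apery set of an abstract numerical semigroup. -/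
def ApS (T : Set ℕ) (u : ℕ) : Set ℕ := {w ∈ T | ¬ ∃ b ∈ T, w = b + u}


theorem blow_sum {t : ℕ} (g : Fin (t + 1) → ℕ) (c : Fin (t + 1) → ℕ) :
    ∑ i, c i * blowD g i = c 0 * g 0 + ∑ i : Fin t, c i.succ * (g i.succ - g 0) := by
  rw [Fin.sum_univ_succ]
  simp [blowD, Fin.succ_ne_zero]

theorem g_sum {t : ℕ} (g : Fin (t + 1) → ℕ) (hS : IsNumSgp g) (c : Fin (t + 1) → ℕ) :
    ∑ i, c i * g i = (∑ i, c i) * g 0 + ∑ i : Fin t, c i.succ * (g i.succ - g 0) := by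
  rw [Fin.sum_univ_succ, Fin.sum_univ_succ, add_mul, add_assoc, Finset.sum_mul,
    ← Finset.sum_add_distrib]
  congr 1
  apply Finset.sum_congr rfl
  intro i _
  have h : g 0 < g i.succ := hS.mono (Fin.succ_pos i)
  rw [← mul_add]
  congr 1
  omega

theorem blow_pos {t : ℕ} (g : Fin (t + 1) → ℕ) (hS : IsNumSgp g) (i : Fin (t + 1)) :
    1 ≤ blowD g i := by
  unfold blowD
  split_ifs with h
  · exact hS.pos
  · have h : g 0 < g i := hS.mono (Fin.pos_iff_ne_zero.mpr h)
    omega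

theorem len_le_ord {t : ℕ} (d : Fin (t + 1) → ℕ) (hd : ∀ i, 1 ≤ d i) (n : ℕ)
    (c : Fin (t + 1) → ℕ) (hc : c ∈ Fac d n) : ∑ i, c i ≤ ordOf d n := by
  unfold ordOf
  apply le_csSup
  · refine ⟨n, ?_⟩
    rintro r ⟨c, hc, rfl⟩
    rw [← show ∑ i, c i * d i = n from hc]
    exact Finset.sum_le_sum fun i _ => Nat.le_mul_of_pos_right _ (hd i)
  · exact ⟨c, hc, rfl⟩

/-- Proposition 3.5(2). -/
theorem stmt5 {t : ℕ} (g : Fin (t + 1) → ℕ) (hS : IsNumSgp g)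
    (f : ℕ) (hf : f ∈ Ap (blowD g) (g 0)) :
    ∀ k : ℕ,
      dmaxEl g (f + ordOf (blowD g) f * g 0 + k * g 0) = denum (blowD g) f := by
  intro k
  obtain ⟨⟨c₀, hc₀⟩, hap⟩ := hf
  set m := ordOf (blowD g) f with hm
  set n := f + m * g 0 + k * g 0 with hn
  have key : ∀ (p : ℕ) (x : Fin t → ℕ),
      p * g 0 + ∑ i : Fin t, x i * (g i.succ - g 0) = f → p = 0 := by
    intro p x h
    by_contra hp
    obtain ⟨q, rfl⟩ := Nat.exists_eq_succ_of_ne_zero hp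
    refine hap ⟨_, ⟨Fin.cons q x, rfl⟩, ?_⟩
    rw [blow_sum]
    simp only [Fin.cons_zero, Fin.cons_succ]
    rw [← h, Nat.succ_mul]
    ring
  have hlen : ∀ c ∈ Fac (blowD g) f, c 0 = 0 ∧ ∑ i : Fin t, c i.succ ≤ m ∧
      ∑ i : Fin t, c i.succ * (g i.succ - g 0) = f := by
    intro c hc
    have h1 := len_le_ord _ (blow_pos g hS) f c hc
    have h2 : ∑ i, c i * blowD g i = f := hc
    rw [blow_sum] at h2
    have h0 := key (c 0) (fun i => c i.succ) h2
    rw [Fin.sum_univ_succ, h0] at h1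
    rw [h0] at h2
    refine ⟨h0, by omega, by omega⟩
  let φ : (Fin (t + 1) → ℕ) → (Fin (t + 1) → ℕ) :=
    fun c => Fin.cons (m + k - ∑ i : Fin t, c i.succ) (fun i => c i.succ)
  have hφlen : ∀ c ∈ Fac (blowD g) f, ∑ i, φ c i = m + k := by
    intro c hc
    obtain ⟨_, h1, _⟩ := hlen c hc
    rw [Fin.sum_univ_succ]
    simp only [φ, Fin.cons_zero, Fin.cons_succ]
    omega
  have hφ : ∀ c ∈ Fac (blowD g) f, φ c ∈ Fac g n := by
    intro c hc
    obtain ⟨_, _, h2⟩ := hlen c hc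
    change ∑ i, φ c i * g i = n
    rw [g_sum g hS, hφlen c hc]
    simp only [φ, Fin.cons_succ]
    rw [h2, hn]
    ring
  have hup : ∀ c ∈ Fac g n, ∑ i, c i ≤ m + k := by
    intro c hc
    by_contra hlt
    push Not at hlt
    have h : ∑ i, c i * g i = n := hc
    rw [g_sum g hS] at h
    obtain ⟨q, hq⟩ := Nat.exists_eq_add_of_lt hlt
    rw [hq, hn] at h
    have := key (q + 1) (fun i => c i.succ) (by linarith)
    omega
  have hord : ordOf g n = m + k := by
    apply le_antisymm
    · refine csSup_le ⟨_, φ c₀, hφ c₀ hc₀, rfl⟩ ?_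
      rintro r ⟨c, hc, rfl⟩
      exact hup c hc
    · rw [← hφlen c₀ hc₀]
      exact len_le_ord g (fun i => le_trans hS.pos (hS.mono.monotone (Fin.zero_le i))) n _
        (hφ c₀ hc₀)
  unfold dmaxEl denum
  have himg : {c ∈ Fac g n | ∑ i, c i = ordOf g n} = Set.image φ (Fac (blowD g) f) := by
    ext c
    constructor
    · rintro ⟨hc, hl⟩
      rw [hord] at hl
      have h : ∑ i, c i * g i = n := hc
      rw [g_sum g hS, hl, hn] at h
      refine ⟨Fin.cons 0 (fun i => c i.succ), ?_, ?_⟩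
      · change ∑ i, _ * blowD g i = f
        rw [blow_sum]
        simp only [Fin.cons_zero, Fin.cons_succ]
        linarith
      · rw [Fin.sum_univ_succ] at hl
        funext i
        refine Fin.cases ?_ (fun i => ?_) i
        · simp only [φ, Fin.cons_zero, Fin.cons_succ]
          omega
        · simp only [φ, Fin.cons_succ]
    · rintro ⟨d, hd, rfl⟩
      exact ⟨hφ d hd, by rw [hord]; exact hφlen d hd⟩
  rw [himg]
  apply Set.InjOn.ncard_image
  intro c hc d hd h
  funext i
  refine Fin.cases ?_ (fun i => ?_) i
  · rw [(hlen c hc).1, (hlen d hd).1]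
  · have := congrFun h i.succ
    simpa only [φ, Fin.cons_succ] using this
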